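/- arXiv:1907.00497 — 3 statements merged into one kernel-verified Lean document; each statement's English description precedes it below -/
import Mathlib

section
/- Let K = Π_{i=1}^N [a_i, b_i] ⊆ ℝ^N be a hyper-rectangle with side lengths D_i = b_i − a_i > 0, and let g_1,…,g_T ∈ ℝ^N with coordinates g_{t,i}. For each coordinate i, define G_{t,i} = √(Σ_{τ=1}^t g_{τ,i}²), fix P_i ≥ 0, and define the iterates coordinatewise by: w_{1,i} ∈ [a_i,b_i]; w_{t+1,i} = w_{t,i} if G_{t,i} = 0, and otherwise w_{t+1,i} = clamp(w_{t,i} − η_{t,i} g_{t,i}, a_i, b_i) with η_{t,i} = D_i √(P_i/D_i + 1/2) / G_{t,i}. Then for any comparator sequence w*_1,…,w*_T ∈ K satisfying Σ_{t=1}^{T−1} |w*_{t+1,i} − w*_{t,i}| ≤ P_i for each i, the linearized dynamic regret satisfies Σ_{t=1}^T ⟨g_t, w_t − w*_t⟩ ≤ Σ_{i=1}^N 2 D_i √(P_i/D_i + 1/2) √(Σ_{t=1}^T g_{t,i}²). -/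
open scoped BigOperators

/-- Clamping to `[a, b]` does not increase the squared distance to a point of `[a, b]`. -/
theorem sq_clamp_sub_le {a b u x : ℝ} (hu : u ∈ Set.Icc a b) :
    (max a (min b x) - u) ^ 2 ≤ (x - u) ^ 2 := by
  obtain ⟨h₁, h₂⟩ := hu
  rcases le_total b x with h | h
  · rw [min_eq_left h, max_eq_right (h₁.trans h₂)]
    nlinarith
  · rw [min_eq_right h]
    rcases le_total a x with h' | h'
    · rw [max_eq_right h']
    · rw [max_eq_left h']
      nlinarith

/-- One-step regret bound for a projected gradient step of size `s / G'` on an interval. -/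
theorem adaptive_step_regret_le {a b s G G' g u w w' : ℝ} (hs : 0 < s) (hG : 0 ≤ G)
    (hG' : 0 ≤ G') (hsq : G' ^ 2 = G ^ 2 + g ^ 2) (hu : u ∈ Set.Icc a b)
    (hw' : G' ≠ 0 → w' = max a (min b (w - s / G' * g))) :
    g * (w - u) ≤ G' * ((w - u) ^ 2 - (w' - u) ^ 2) / (2 * s) + s * (G' - G) := by
  rcases hG'.eq_or_lt with h0 | hpos
  · subst h0
    have hg : g = 0 := by nlinarith [sq_nonneg G, sq_nonneg g]
    have hGz : G = 0 := by nlinarith [sq_nonneg G, sq_nonneg g]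
    simp [hg, hGz]
  · have hproj : (w' - u) ^ 2 ≤ (w - s / G' * g - u) ^ 2 := by
      rw [hw' hpos.ne']
      exact sq_clamp_sub_le hu
    have hscale : G' ^ 2 * (w' - u) ^ 2 ≤ (G' * (w - u) - s * g) ^ 2 := by
      calc G' ^ 2 * (w' - u) ^ 2 ≤ G' ^ 2 * (w - s / G' * g - u) ^ 2 := by gcongr
        _ = (G' * (w - u) - s * g) ^ 2 := by field_simp; ring
    have hgrad : s ^ 2 * g ^ 2 ≤ s ^ 2 * (2 * G' * (G' - G)) := by
      gcongr
      nlinarith [sq_nonneg (G' - G)]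
    have hmul : G' * (2 * s * (g * (w - u))) ≤
        G' * (G' * ((w - u) ^ 2 - (w' - u) ^ 2) + 2 * s * (s * (G' - G))) := by
      nlinarith
    have hdiv := le_of_mul_le_mul_left hmul hpos
    rw [div_add' _ _ _ (by positivity), le_div_iff₀ (by positivity)]
    linarith

/-- Dynamic regret of adaptive projected gradient descent with step sizes `s / G t` on an
interval, with the final distance to the comparator retained. -/
theorem adaptive_interval_regret_le {a b s : ℝ} (hs : 0 < s) {T : ℕ} {g G w u : ℕ → ℝ}
    (hG : ∀ t, 0 ≤ G t) (hG0 : G 0 = 0) (hsq : ∀ t, G (t + 1) ^ 2 = G t ^ 2 + g (t + 1) ^ 2)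
    (hw : ∀ t, 1 ≤ t → w t ∈ Set.Icc a b)
    (hupd : ∀ t, 1 ≤ t → G t ≠ 0 → w (t + 1) = max a (min b (w t - s / G t * g t)))
    (hu : ∀ t, 1 ≤ t → t ≤ T → u t ∈ Set.Icc a b) (k : ℕ) (hk : k + 1 ≤ T) :
    ∑ t ∈ Finset.Icc 1 (k + 1), g t * (w t - u t) ≤
      G (k + 1) * ((b - a) ^ 2 + 2 * (b - a) * ∑ t ∈ Finset.Icc 1 k, |u (t + 1) - u t|
        - (w (k + 2) - u (k + 1)) ^ 2) / (2 * s) + s * G (k + 1) := by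
  have hstep (t : ℕ) (ht : t + 1 ≤ T) :=
    adaptive_step_regret_le hs (hG t) (hG (t + 1)) (hsq t) (hu (t + 1) (by omega) ht)
      (hupd (t + 1) (by omega))
  have hdist (x y : ℝ) (hx : x ∈ Set.Icc a b) (hy : y ∈ Set.Icc a b) :
      (x - y) ^ 2 ≤ (b - a) ^ 2 := by
    obtain ⟨h₁, h₂⟩ := hx
    obtain ⟨h₃, h₄⟩ := hy
    exact sq_le_sq' (by linarith) (by linarith)
  induction k with
  | zero =>
    have h := hstep 0 hk
    have hd := hdist _ _ (hw 1 le_rfl) (hu 1 le_rfl hk)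
    simp only [zero_add, hG0, sub_zero] at h
    simp only [zero_add, Finset.Icc_self, Finset.sum_singleton, Finset.Icc_eq_empty_of_lt
      Nat.zero_lt_one, Finset.sum_empty, mul_zero, add_zero]
    refine h.trans ?_
    have := hG 1
    gcongr
  | succ k ih =>
    rw [Finset.sum_Icc_succ_top (by omega : 1 ≤ k + 1 + 1),
      Finset.sum_Icc_succ_top (by omega : 1 ≤ k + 1) (fun t => |u (t + 1) - u t|)]
    have hind := ih (by omega)
    have h := hstep (k + 1) hk
    have hwk := hw (k + 2) (by omega)
    have huk := hu (k + 1) (by omega) (by omega)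
    have huk' := hu (k + 2) (by omega) hk
    have hd := hdist _ _ hwk huk
    have hV : 0 ≤ ∑ t ∈ Finset.Icc 1 k, |u (t + 1) - u t| :=
      Finset.sum_nonneg fun _ _ => abs_nonneg _
    have hGmono : G (k + 1) ≤ G (k + 2) :=
      le_of_sq_le_sq (by nlinarith [hsq (k + 1), sq_nonneg (g (k + 2))]) (hG _)
    have hmove : (w (k + 2) - u (k + 2)) ^ 2 ≤
        (w (k + 2) - u (k + 1)) ^ 2 + 2 * (b - a) * |u (k + 2) - u (k + 1)| := by
      obtain ⟨h₁, h₂⟩ := hwk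
      obtain ⟨h₃, h₄⟩ := huk
      obtain ⟨h₅, h₆⟩ := huk'
      rcases abs_cases (u (k + 2) - u (k + 1)) with ⟨e, he⟩ | ⟨e, he⟩ <;> rw [e] <;> nlinarith
    have hab : 0 ≤ b - a := by linarith [hwk.1, hwk.2]
    simp only [add_assoc, Nat.reduceAdd] at h hind ⊢
    generalize (∑ t ∈ Finset.Icc 1 k, |u (t + 1) - u t|) = V at *
    have hVD : 0 ≤ (b - a) * V := mul_nonneg hab hV
    have hpot : G (k + 1) * ((b - a) ^ 2 + 2 * (b - a) * V - (w (k + 2) - u (k + 1)) ^ 2) +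
        G (k + 2) * ((w (k + 2) - u (k + 2)) ^ 2 - (w (k + 3) - u (k + 2)) ^ 2) ≤
        G (k + 2) * ((b - a) ^ 2 + 2 * (b - a) * (V + |u (k + 2) - u (k + 1)|) -
          (w (k + 3) - u (k + 2)) ^ 2) := by
      have h₁ := mul_le_mul_of_nonneg_right hGmono (by linarith :
        0 ≤ (b - a) ^ 2 + 2 * (b - a) * V - (w (k + 2) - u (k + 1)) ^ 2)
      have h₂ := mul_le_mul_of_nonneg_left hmove (hG (k + 2))
      linarith
    have hdiv := div_le_div_of_nonneg_right hpot (by positivity : 0 ≤ 2 * s)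
    rw [add_div] at hdiv
    linarith

/-- Coordinatewise adaptive projected sub-gradient descent on a
hyper-rectangle: per-coordinate dynamic regret bound (Remark 1). -/
theorem coordinatewise_adaptive_pgd_dynamic_regret
    (N : ℕ) (a b : Fin N → ℝ) (hab : ∀ i, a i < b i)
    (D : Fin N → ℝ) (hD : ∀ i, D i = b i - a i)
    (T : ℕ) (hT : 1 ≤ T)
    (g : ℕ → Fin N → ℝ)
    (G : ℕ → Fin N → ℝ)
    (hG : ∀ t i, G t i = Real.sqrt (∑ τ ∈ Finset.Icc 1 t, (g τ i) ^ 2))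
    (P : Fin N → ℝ) (hPnn : ∀ i, 0 ≤ P i)
    (w : ℕ → Fin N → ℝ)
    (hw1 : ∀ i, w 1 i ∈ Set.Icc (a i) (b i))
    (hwupd : ∀ t i, 1 ≤ t →
      (G t i = 0 → w (t + 1) i = w t i) ∧
      (G t i ≠ 0 → w (t + 1) i =
        max (a i) (min (b i)
          (w t i - (D i * Real.sqrt (P i / D i + 1 / 2) / G t i) * g t i))))
    (wstar : ℕ → Fin N → ℝ)
    (hwstar : ∀ t i, 1 ≤ t → t ≤ T → wstar t i ∈ Set.Icc (a i) (b i))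
    (hpath : ∀ i, ∑ t ∈ Finset.Icc 1 (T - 1), |wstar (t + 1) i - wstar t i| ≤ P i) :
    ∑ t ∈ Finset.Icc 1 T, ∑ i, g t i * (w t i - wstar t i) ≤
      ∑ i, 2 * D i * Real.sqrt (P i / D i + 1 / 2) *
        Real.sqrt (∑ t ∈ Finset.Icc 1 T, (g t i) ^ 2) := by
  rw [Finset.sum_comm]
  refine Finset.sum_le_sum fun i _ => ?_
  obtain ⟨k, rfl⟩ : ∃ k, T = k + 1 := ⟨T - 1, by omega⟩
  have hDpos : 0 < D i := by linarith [hD i, hab i]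
  have hq : 0 < P i / D i + 1 / 2 := by
    have := div_nonneg (hPnn i) hDpos.le
    linarith
  set c := Real.sqrt (P i / D i + 1 / 2) with hc
  have hcpos : 0 < c := Real.sqrt_pos.mpr hq
  have hcsq : 2 * (D i * c) ^ 2 = D i ^ 2 + 2 * D i * P i := by
    rw [mul_pow, hc, Real.sq_sqrt hq.le]
    field_simp
    ring
  have hGsq (t : ℕ) : G t i ^ 2 = ∑ τ ∈ Finset.Icc 1 t, (g τ i) ^ 2 := by
    rw [hG, Real.sq_sqrt (Finset.sum_nonneg fun _ _ => sq_nonneg _)]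
  have hGnn (t : ℕ) : 0 ≤ G t i := by
    rw [hG]
    exact Real.sqrt_nonneg _
  have hw (t : ℕ) (ht : 1 ≤ t) : w t i ∈ Set.Icc (a i) (b i) := by
    induction t, ht using Nat.le_induction with
    | base => exact hw1 i
    | succ t ht ih =>
      by_cases h0 : G t i = 0
      · rwa [(hwupd t i ht).1 h0]
      · rw [(hwupd t i ht).2 h0]
        exact ⟨le_max_left _ _, max_le (hab i).le (min_le_left _ _)⟩
  have hreg := adaptive_interval_regret_le (g := fun t => g t i) (G := fun t => G t i)
    (w := fun t => w t i) (u := fun t => wstar t i) (mul_pos hDpos hcpos) hGnn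
    (by simp [hG]) (fun t => by rw [hGsq, hGsq, Finset.sum_Icc_succ_top (by omega)]) hw
    (fun t ht => (hwupd t i ht).2) (fun t => hwstar t i) k le_rfl
  have hP := hpath i
  rw [Nat.add_sub_cancel] at hP
  rw [← hG]
  refine hreg.trans ?_
  have hbound : G (k + 1) i * ((b i - a i) ^ 2 + 2 * (b i - a i) *
      ∑ t ∈ Finset.Icc 1 k, |wstar (t + 1) i - wstar t i|
        - (w (k + 2) i - wstar (k + 1) i) ^ 2) / (2 * (D i * c)) ≤ D i * c * G (k + 1) i := by
    rw [div_le_iff₀ (by positivity), ← hD]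
    have h₁ := mul_le_mul_of_nonneg_left hP (by positivity : 0 ≤ 2 * D i)
    calc _ ≤ G (k + 1) i * (2 * (D i * c) ^ 2) := by
          refine mul_le_mul_of_nonneg_left ?_ (hGnn _)
          linarith [sq_nonneg (w (k + 2) i - wstar (k + 1) i)]
      _ = _ := by ring
  linarith
end

section
/- Let D > 0, P ≥ 0, G > 0, and let T be a positive integer with ⌊P/D⌋ + 1 ≤ T. For every causal algorithm on the decision set [0, D] — i.e., every family of maps A_t : ℝ^{t−1} → [0, D] for t = 1,…,T producing decisions w_t = A_t(g_1,…,g_{t−1}) — there exist loss sub-gradients g_1,…,g_T ∈ ℝ with Σ_{t=1}^T g_t² = G² and a comparator sequence w*_1,…,w*_T ∈ [0, D] with Σ_{t=1}^{T−1} |w*_{t+1} − w*_t| ≤ P such that Σ_{t=1}^T g_t (w_t − w*_t) ≥ (D √(⌊P/D⌋ + 1) / (2√2)) · G. -/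
open scoped BigOperators

/-- Against a causal algorithm, any adversary answering the current decision is realised by a
fixed sequence on a finite horizon. -/
theorem exists_adaptive_sequence_of_causal {α β : Type*} [Nonempty β]
    (A : ℕ → (ℕ → β) → α)
    (hA : ∀ t (g g' : ℕ → β), (∀ s, 1 ≤ s → s < t → g s = g' s) → A t g = A t g')
    (F : ℕ → α → β) (n : ℕ) :
    ∃ g : ℕ → β, ∀ t, 1 ≤ t → t ≤ n → g t = F t (A t g) := by
  induction n with
  | zero => exact ⟨fun _ => Classical.arbitrary β, fun t h1 h2 => by omega⟩
  | succ n ih =>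
    obtain ⟨g, hg⟩ := ih
    refine ⟨Function.update g (n + 1) (F (n + 1) (A (n + 1) g)), fun t h1 h2 => ?_⟩
    have hcausal : A t (Function.update g (n + 1) (F (n + 1) (A (n + 1) g))) = A t g :=
      hA t _ _ fun s _ hs => Function.update_of_ne (by omega) _ _
    rw [hcausal]
    rcases Nat.lt_or_ge n t with h | h
    · obtain rfl : t = n + 1 := by omega
      simp
    · rw [Function.update_of_ne (by omega), hg t h1 h]

/-- Worst-case dynamic regret lower bound under the sub-gradient energy
constraint Σ g_t² = G² for any causal algorithm on [0, D] (Theorem 2). -/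
theorem dynamic_regret_lower_bound_energy_constraint
    (D P G : ℝ) (hD : 0 < D) (hP : 0 ≤ P) (hG : 0 < G)
    (T : ℕ) (hT : 1 ≤ T) (hPT : ⌊P / D⌋₊ + 1 ≤ T)
    (A : ℕ → (ℕ → ℝ) → ℝ)
    (hA_causal : ∀ t (g g' : ℕ → ℝ),
      (∀ s, 1 ≤ s → s < t → g s = g' s) → A t g = A t g')
    (hA_range : ∀ t (g : ℕ → ℝ), A t g ∈ Set.Icc 0 D) :
    ∃ (g : ℕ → ℝ) (wstar : ℕ → ℝ),
      (∑ t ∈ Finset.Icc 1 T, (g t) ^ 2 = G ^ 2) ∧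
      (∀ t, 1 ≤ t → t ≤ T → wstar t ∈ Set.Icc 0 D) ∧
      (∑ t ∈ Finset.Icc 1 (T - 1), |wstar (t + 1) - wstar t| ≤ P) ∧
      D * Real.sqrt (⌊P / D⌋₊ + 1) / (2 * Real.sqrt 2) * G ≤
        ∑ t ∈ Finset.Icc 1 T, g t * (A t g - wstar t) := by
  obtain ⟨k, hk⟩ : ∃ k, k = ⌊P / D⌋₊ := ⟨_, rfl⟩
  rw [← hk] at hPT ⊢
  have hkP : (k : ℝ) * D ≤ P := by
    rw [← le_div_iff₀ hD, hk]
    exact Nat.floor_le (by positivity)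
  obtain ⟨r, hr⟩ : ∃ r, r = Real.sqrt ((k : ℝ) + 1) := ⟨_, rfl⟩
  have hr0 : 0 < r := by rw [hr]; positivity
  have hr2 : r ^ 2 = (k : ℝ) + 1 := by rw [hr]; exact Real.sq_sqrt (by positivity)
  rw [← hr]
  obtain ⟨g, hg⟩ := exists_adaptive_sequence_of_causal A hA_causal
    (fun t x => if t ≤ k + 1 then (if D / 2 ≤ x then G / r else -(G / r)) else 0) T
  have hsub : Finset.Icc 1 (k + 1) ⊆ Finset.Icc 1 T := Finset.Icc_subset_Icc_right hPT
  have hg_zero : ∀ t ∈ Finset.Icc 1 T, t ∉ Finset.Icc 1 (k + 1) → g t = 0 := by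
    intro t ht ht'
    rw [Finset.mem_Icc] at ht ht'
    rw [hg t ht.1 ht.2, if_neg (by omega)]
  have hg_active : ∀ t ∈ Finset.Icc 1 (k + 1),
      g t = if D / 2 ≤ A t g then G / r else -(G / r) := by
    intro t ht
    rw [Finset.mem_Icc] at ht
    rw [hg t ht.1 (by omega), if_pos ht.2]
  -- The comparator opposes the gradient while it is active, and is constant afterwards.
  refine ⟨g, fun t => if D / 2 ≤ A (min t (k + 1)) g then 0 else D, ?_, ?_, ?_, ?_⟩
  · rw [← Finset.sum_subset hsub fun t ht ht' => by rw [hg_zero t ht ht']; simp]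
    have hsq : ∀ t ∈ Finset.Icc 1 (k + 1), g t ^ 2 = (G / r) ^ 2 := by
      intro t ht
      rw [hg_active t ht]
      split_ifs <;> ring
    rw [Finset.sum_congr rfl hsq, Finset.sum_const, Nat.card_Icc, nsmul_eq_mul, div_pow, hr2]
    push_cast [Nat.add_sub_cancel]
    field_simp
  · intro t _ _
    dsimp only
    split_ifs
    · exact ⟨le_rfl, hD.le⟩
    · exact ⟨hD.le, le_rfl⟩
  · dsimp only
    rw [← Finset.sum_subset (Finset.Icc_subset_Icc_right (show k ≤ T - 1 by omega))]
    · refine le_trans (Finset.sum_le_card_nsmul _ _ D fun t _ => ?_) ?_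
      · split_ifs <;> simp [abs_of_pos hD, hD.le]
      · simpa using hkP
    · intro t ht ht'
      rw [Finset.mem_Icc] at ht ht'
      rw [min_eq_right (by omega : k + 1 ≤ t + 1), min_eq_right (by omega : k + 1 ≤ t)]
      simp
  · rw [← Finset.sum_subset hsub fun t ht ht' => by rw [hg_zero t ht ht']; simp]
    have hround : ∀ t ∈ Finset.Icc 1 (k + 1), G / r * (D / 2) ≤
        g t * (A t g - if D / 2 ≤ A (min t (k + 1)) g then 0 else D) := by
      intro t ht
      have hGr : 0 < G / r := by positivity
      rw [hg_active t ht, min_eq_left (Finset.mem_Icc.mp ht).2]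
      split_ifs with h <;> nlinarith
    refine le_trans ?_ (Finset.card_nsmul_le_sum _ _ _ hround)
    have hsqrt : 1 ≤ Real.sqrt 2 := Real.one_le_sqrt.mpr (by norm_num)
    calc D * r / (2 * Real.sqrt 2) * G ≤ D * r / 2 * G := by
          gcongr
          linarith
      _ = r ^ 2 * (G / r * (D / 2)) := by field_simp
      _ = (Finset.Icc 1 (k + 1)).card • (G / r * (D / 2)) := by simp [hr2]
end

section
/- Let D > 0, P ≥ 0, L > 0, and let T be a positive integer with ⌊P/D⌋ + 1 ≤ T. For every causal algorithm on the decision set [0, D] — i.e., every family of maps A_t : ℝ^{t−1} → [0, D] for t = 1,…,T producing decisions w_t = A_t(g_1,…,g_{t−1}) — there exist loss sub-gradients g_1,…,g_T ∈ ℝ with max_{1≤t≤T} |g_t| ≤ L and a comparator sequence w*_1,…,w*_T ∈ [0, D] with Σ_{t=1}^{T−1} |w*_{t+1} − w*_t| ≤ P such that Σ_{t=1}^T g_t (w_t − w*_t) ≥ (D √(⌊P/D⌋ + 1) / 4) · L √T. -/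
open scoped BigOperators

/-- If a potential `F` dominates its average over the two moves `±L`, then against any causal
algorithm some signs `±L` on the `n` rounds after round `s` preserve the potential. -/
lemma exists_signs_of_potential {L : ℝ} (hL : 0 < L) (c : ℝ)
    (A : ℕ → (ℕ → ℝ) → ℝ)
    (hA : ∀ t (g g' : ℕ → ℝ), (∀ s, 1 ≤ s → s < t → g s = g' s) → A t g = A t g')
    (F : ℕ → ℝ → ℝ) (hF : ∀ n x, 2 * F (n + 1) x ≤ F n (x + L) + F n (x - L))
    (n s : ℕ) (g₀ : ℕ → ℝ) (x : ℝ) :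
    ∃ g : ℕ → ℝ, (∀ t ≤ s, g t = g₀ t) ∧ (∀ i < n, |g (s + i + 1)| ≤ L) ∧
      F n x ≤ ∑ i ∈ Finset.range n, g (s + i + 1) * (A (s + i + 1) g - c) +
        F 0 (x + ∑ i ∈ Finset.range n, g (s + i + 1)) := by
  induction n generalizing s g₀ x with
  | zero => exact ⟨g₀, fun _ _ => rfl, by simp, by simp⟩
  | succ n ih =>
    obtain ⟨e, he, hstep⟩ : ∃ e : ℝ, |e| ≤ L ∧
        F (n + 1) x ≤ e * (A (s + 1) g₀ - c) + F n (x + e) := by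
      by_contra! h
      have hplus := h L (abs_of_pos hL).le
      have hminus := h (-L) (by rw [abs_neg, abs_of_pos hL])
      have := hF n x
      rw [← sub_eq_add_neg] at hminus
      linarith
    obtain ⟨g, hagree, hbound, hsum⟩ := ih (s + 1) (Function.update g₀ (s + 1) e) (x + e)
    have hnew : g (s + 1) = e := by simpa using hagree (s + 1) le_rfl
    have hold : ∀ t ≤ s, g t = g₀ t := fun t ht => by
      rw [hagree t (by omega), Function.update_of_ne (by omega)]
    have hshift : ∀ i, s + (i + 1) + 1 = s + 1 + i + 1 := fun i => by omega
    refine ⟨g, hold, ?_, ?_⟩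
    · rintro (_ | i) hi
      · simpa [hnew] using he
      · rw [hshift]
        exact hbound i (by omega)
    · have hAs : A (s + 1) g = A (s + 1) g₀ := hA _ _ _ fun t _ ht => hold t (by omega)
      rw [Finset.sum_range_succ', Finset.sum_range_succ']
      simp only [hshift, add_zero, hnew, hAs]
      have hx : x + (∑ i ∈ Finset.range n, g (s + 1 + i + 1) + e) =
          x + e + ∑ i ∈ Finset.range n, g (s + 1 + i + 1) := by ring
      rw [hx]
      linarith

/-- The tangent quartic below the absolute value, touching it at `±C`. -/
lemma quartic_le_abs {C : ℝ} (hC : 0 < C) (y : ℝ) :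
    (3 * C ^ 2 * y ^ 2 - y ^ 4) / (2 * C ^ 3) ≤ |y| := by
  rw [div_le_iff₀ (by positivity), ← sq_abs y, ← Even.pow_abs (by decide : Even 4) y]
  have hy := abs_nonneg y
  have : 0 ≤ |y| * ((|y| - C) ^ 2 * (|y| + 2 * C)) := by positivity
  linarith

/-- The expectation of `quartic_le_abs` at `x` plus a sum of `n` independent uniform `±L` signs. -/
noncomputable def quarticPotential (D L C : ℝ) (n : ℕ) (x : ℝ) : ℝ :=
  D / 2 * ((3 * C ^ 2 * (x ^ 2 + n * L ^ 2) -
    (x ^ 4 + 6 * x ^ 2 * n * L ^ 2 + (3 * n ^ 2 - 2 * n) * L ^ 4)) / (2 * C ^ 3))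

lemma le_quarticPotential_zero {D L : ℝ} (hD : 0 < D) (hL : 0 < L) {n : ℕ} (hn : 1 ≤ n) :
    D * L * √(n + 1) / 4 ≤ quarticPotential D L (L * √(3 * n - 2)) n 0 := by
  have hn' : (1 : ℝ) ≤ n := by exact_mod_cast hn
  have hc : 0 < √(3 * n - 2 : ℝ) := Real.sqrt_pos.2 (by linarith)
  have hc2 : √(3 * n - 2 : ℝ) ^ 2 = 3 * n - 2 := Real.sq_sqrt (by linarith)
  have heq : quarticPotential D L (L * √(3 * n - 2)) n 0 = D * L / 2 * (n / √(3 * n - 2)) := by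
    unfold quarticPotential
    generalize √(3 * n - 2 : ℝ) = c at hc hc2
    have h4 : (3 * n ^ 2 - 2 * n : ℝ) = n * c ^ 2 := by rw [hc2]; ring
    rw [h4]
    field_simp
    ring
  have hroot : √(n + 1 : ℝ) / 2 ≤ n / √(3 * n - 2) := by
    rw [le_div_iff₀ hc, div_mul_eq_mul_div, div_le_iff₀ two_pos,
      ← Real.sqrt_mul (by positivity)]
    refine Real.sqrt_le_iff.2 ⟨by positivity, ?_⟩
    nlinarith
  rw [heq]
  have := mul_le_mul_of_nonneg_left hroot (by positivity : 0 ≤ D * L / 2)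
  linarith

/-- Static regret lower bound on a block of `n` rounds following an arbitrary history. -/
lemma exists_block_regret {D L : ℝ} (hD : 0 < D) (hL : 0 < L)
    (A : ℕ → (ℕ → ℝ) → ℝ)
    (hA : ∀ t (g g' : ℕ → ℝ), (∀ s, 1 ≤ s → s < t → g s = g' s) → A t g = A t g')
    {n : ℕ} (hn : 1 ≤ n) (s : ℕ) (g₀ : ℕ → ℝ) :
    ∃ (g : ℕ → ℝ) (u : ℝ), (∀ t ≤ s, g t = g₀ t) ∧ (∀ i < n, |g (s + i + 1)| ≤ L) ∧
      u ∈ Set.Icc 0 D ∧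
      D * L * √(n + 1) / 4 ≤
        ∑ i ∈ Finset.range n, g (s + i + 1) * (A (s + i + 1) g - u) := by
  have hn' : (1 : ℝ) ≤ n := by exact_mod_cast hn
  set C := L * √(3 * n - 2 : ℝ) with hC
  have hCpos : 0 < C := mul_pos hL (Real.sqrt_pos.2 (by linarith))
  obtain ⟨g, hagree, hbound, hsum⟩ := exists_signs_of_potential hL (D / 2) A hA
    (quarticPotential D L C)
    (fun n x => le_of_eq (by unfold quarticPotential; push_cast; ring)) n s g₀ 0
  set G := ∑ i ∈ Finset.range n, g (s + i + 1) with hG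
  have hend : quarticPotential D L C 0 (0 + G) ≤ D / 2 * |G| := by
    have := mul_le_mul_of_nonneg_left (quartic_le_abs hCpos G) (by positivity : 0 ≤ D / 2)
    simpa [quarticPotential] using this
  obtain ⟨u, hu, huG⟩ : ∃ u ∈ Set.Icc 0 D, D / 2 * |G| = (D / 2 - u) * G := by
    rcases le_total 0 G with h | h
    · exact ⟨0, ⟨le_rfl, hD.le⟩, by rw [abs_of_nonneg h]; ring⟩
    · exact ⟨D, ⟨hD.le, le_rfl⟩, by rw [abs_of_nonpos h]; ring⟩
  refine ⟨g, u, hagree, hbound, hu, ?_⟩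
  have hsplit : ∑ i ∈ Finset.range n, g (s + i + 1) * (A (s + i + 1) g - u) =
      ∑ i ∈ Finset.range n, g (s + i + 1) * (A (s + i + 1) g - D / 2) + (D / 2 - u) * G := by
    rw [hG, Finset.mul_sum, ← Finset.sum_add_distrib]
    exact Finset.sum_congr rfl fun i _ => by ring
  have := le_quarticPotential_zero hD hL hn
  rw [← hC] at this
  rw [hsplit]
  linarith

/-- Dynamic regret lower bound over `k + 1` consecutive blocks of length `n`, against a comparator
that moves at most `k` times. -/
lemma exists_blocks_regret {D L : ℝ} (hD : 0 < D) (hL : 0 < L)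
    (A : ℕ → (ℕ → ℝ) → ℝ)
    (hA : ∀ t (g g' : ℕ → ℝ), (∀ s, 1 ≤ s → s < t → g s = g' s) → A t g = A t g')
    {n : ℕ} (hn : 1 ≤ n) (k : ℕ) :
    ∃ g w : ℕ → ℝ, (∀ i < (k + 1) * n, |g (i + 1)| ≤ L) ∧ (∀ t, w t ∈ Set.Icc 0 D) ∧
      (∀ N, ∑ t ∈ Finset.Icc 1 N, |w (t + 1) - w t| ≤ k * D) ∧
      (k + 1) * (D * L * √(n + 1) / 4) ≤
        ∑ i ∈ Finset.range ((k + 1) * n), g (i + 1) * (A (i + 1) g - w (i + 1)) := by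
  induction k with
  | zero =>
    obtain ⟨g, u, -, hbound, hu, hsum⟩ := exists_block_regret hD hL A hA hn 0 0
    exact ⟨g, fun _ => u, by simpa using hbound, fun _ => hu, by simp, by simpa using hsum⟩
  | succ k ih =>
    obtain ⟨g₀, w₀, hbound₀, hw₀, hvar₀, hsum₀⟩ := ih
    set s := (k + 1) * n with hs
    obtain ⟨g, u, hagree, hbound, hu, hsum⟩ := exists_block_regret hD hL A hA hn s g₀
    have hlen : (k + 1 + 1) * n = s + n := by rw [hs]; ring
    have hw : ∀ t, (if t ≤ s then w₀ t else u) ∈ Set.Icc 0 D := fun t => by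
      split_ifs
      exacts [hw₀ t, hu]
    refine ⟨g, fun t => if t ≤ s then w₀ t else u, ?_, hw, fun N => ?_, ?_⟩
    · intro i hi
      rcases lt_or_ge i s with h | h
      · rw [hagree _ (by omega)]
        exact hbound₀ i h
      · obtain ⟨j, rfl⟩ := Nat.exists_eq_add_of_le h
        exact hbound j (by omega)
    · have hpt : ∀ t, |(if t + 1 ≤ s then w₀ (t + 1) else u) - (if t ≤ s then w₀ t else u)| ≤
          |w₀ (t + 1) - w₀ t| + if t = s then D else 0 := by
        intro t
        rcases lt_trichotomy t s with h | rfl | h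
        · simp [h.le, h.ne, Nat.succ_le_of_lt h]
        · have hdist := abs_sub_le_of_le_of_le hu.1 hu.2 (hw₀ s).1 (hw₀ s).2
          simp only [Nat.not_succ_le_self, le_refl, if_true, if_false]
          have := abs_nonneg (w₀ (s + 1) - w₀ s)
          linarith
        · simp [h.not_ge, h.ne', (h.trans (Nat.lt_succ_self t)).not_ge]
      have hjump : ∑ t ∈ Finset.Icc 1 N, (if t = s then D else 0) ≤ D := by
        rw [Finset.sum_ite_eq']
        split_ifs
        exacts [le_rfl, hD.le]
      refine (Finset.sum_le_sum fun t _ => hpt t).trans ?_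
      rw [Finset.sum_add_distrib]
      push_cast
      linarith [hvar₀ N]
    · rw [hlen, Finset.sum_range_add]
      have hfst : ∑ i ∈ Finset.range s,
          g (i + 1) * (A (i + 1) g - if i + 1 ≤ s then w₀ (i + 1) else u) =
          ∑ i ∈ Finset.range s, g₀ (i + 1) * (A (i + 1) g₀ - w₀ (i + 1)) := by
        refine Finset.sum_congr rfl fun i hi => ?_
        have hi : i < s := Finset.mem_range.1 hi
        rw [if_pos (by omega), hagree _ (by omega),
          hA (i + 1) g g₀ fun t _ ht => hagree t (by omega)]
      have hsnd : ∑ i ∈ Finset.range n,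
          g (s + i + 1) * (A (s + i + 1) g - if s + i + 1 ≤ s then w₀ (s + i + 1) else u) =
          ∑ i ∈ Finset.range n, g (s + i + 1) * (A (s + i + 1) g - u) :=
        Finset.sum_congr rfl fun i _ => by rw [if_neg (by omega)]
      rw [hfst, hsnd]
      push_cast
      linarith

/-- Worst-case dynamic regret lower bound under the uniform sub-gradient
bound max|g_t| ≤ L for any causal algorithm on [0, D] (Corollary 3). -/
theorem dynamic_regret_lower_bound_max_constraint
    (D P L : ℝ) (hD : 0 < D) (hP : 0 ≤ P) (hL : 0 < L)
    (T : ℕ) (hT : 1 ≤ T) (hPT : ⌊P / D⌋₊ + 1 ≤ T)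
    (A : ℕ → (ℕ → ℝ) → ℝ)
    (hA_causal : ∀ t (g g' : ℕ → ℝ),
      (∀ s, 1 ≤ s → s < t → g s = g' s) → A t g = A t g')
    (hA_range : ∀ t (g : ℕ → ℝ), A t g ∈ Set.Icc 0 D) :
    ∃ (g : ℕ → ℝ) (wstar : ℕ → ℝ),
      (∀ t, 1 ≤ t → t ≤ T → |g t| ≤ L) ∧
      (∀ t, 1 ≤ t → t ≤ T → wstar t ∈ Set.Icc 0 D) ∧
      (∑ t ∈ Finset.Icc 1 (T - 1), |wstar (t + 1) - wstar t| ≤ P) ∧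
      D * Real.sqrt (⌊P / D⌋₊ + 1) / 4 * (L * Real.sqrt T) ≤
        ∑ t ∈ Finset.Icc 1 T, g t * (A t g - wstar t) := by
  have hk : (⌊P / D⌋₊ : ℝ) * D ≤ P :=
    (le_div_iff₀ hD).1 (Nat.floor_le (div_nonneg hP hD.le))
  generalize ⌊P / D⌋₊ = k at hk hPT
  set n := T / (k + 1) with hn_def
  have hn : 1 ≤ n := (Nat.one_le_div_iff k.succ_pos).2 hPT
  obtain ⟨g₀, w, hbound, hw, hvar, hsum⟩ := exists_blocks_regret hD hL A hA_causal hn k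
  set s := (k + 1) * n with hs
  have hsT : s ≤ T := Nat.mul_div_le T (k + 1)
  have hTs : T ≤ (k + 1) * (n + 1) := (Nat.lt_mul_div_succ T k.succ_pos).le
  -- the rounds left over after the last full block carry zero sub-gradients
  refine ⟨fun t => if t ≤ s then g₀ t else 0, w, ?_, fun t _ _ => hw t, (hvar _).trans hk, ?_⟩
  · intro t ht _
    obtain ⟨i, rfl⟩ := Nat.exists_eq_add_of_le' ht
    by_cases h : i + 1 ≤ s
    · simpa [h] using hbound i h
    · simpa [h] using hL.le
  · set g : ℕ → ℝ := fun t => if t ≤ s then g₀ t else 0 with hg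
    have hregret : ∑ t ∈ Finset.Icc 1 T, g t * (A t g - w t) =
        ∑ i ∈ Finset.range s, g₀ (i + 1) * (A (i + 1) g₀ - w (i + 1)) := by
      have hshift : ∑ t ∈ Finset.Icc 1 T, g t * (A t g - w t) =
          ∑ i ∈ Finset.range T, g (i + 1) * (A (i + 1) g - w (i + 1)) := by
        rw [Finset.range_eq_Ico, Finset.sum_Ico_add' (fun t => g t * (A t g - w t)) 0 T 1]
        rfl
      rw [hshift, ← Nat.add_sub_of_le hsT, Finset.sum_range_add,
        Finset.sum_eq_zero (s := Finset.range (T - s)), add_zero]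
      · refine Finset.sum_congr rfl fun i hi => ?_
        have hi : i < s := Finset.mem_range.1 hi
        have hagree : ∀ t ≤ s, g t = g₀ t := fun t ht => if_pos ht
        rw [hagree _ hi, hA_causal (i + 1) g g₀ fun t _ ht => hagree t (by omega)]
      · intro i _
        have : g (s + i + 1) = 0 := if_neg (by omega)
        rw [this, zero_mul]
    rw [hregret]
    refine le_trans ?_ hsum
    have hTs' : (T : ℝ) ≤ (k + 1) * (n + 1) := by exact_mod_cast hTs
    have hroot : √(k + 1 : ℝ) * √T ≤ (k + 1) * √(n + 1) := by
      calc √(k + 1 : ℝ) * √T ≤ √(k + 1 : ℝ) * √((k + 1) * (n + 1)) := by gcongr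
        _ = √(k + 1 : ℝ) * √(k + 1 : ℝ) * √(n + 1) := by
          rw [Real.sqrt_mul (by positivity), mul_assoc]
        _ = (k + 1) * √(n + 1) := by rw [Real.mul_self_sqrt (by positivity)]
    have := mul_le_mul_of_nonneg_left hroot (by positivity : 0 ≤ D * L / 4)
    linarith
end
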